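/- arXiv:0910.4639 — 2 statements merged into one kernel-verified Lean document; each statement's English description precedes it below -/
import Mathlib

section
/- A commutative ring R is Gorenstein Von Neumann regular (every R-module is Gorenstein flat) if and only if R is coherent and self-FP-injective (i.e., R is FP-injective as a module over itself); such rings are the weakly quasi-Frobenius (FC) rings. -/
universe u

/-- An `R`-module `M` is **Gorenstein flat** if there exists an exact complex
`F : ⋯ → F₋₁ → F₀ → F₁ → ⋯` of flat `R`-modules with `M` isomorphic to the image
of `F₀ → F₁`, such that `I ⊗_R F` is exact for every injective `R`-module `I`. -/
def IsGorensteinFlat (R : Type u) [CommRing R] (M : Type u)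
    [AddCommGroup M] [Module R M] : Prop :=
  ∃ (F : ℤ → ModuleCat.{u} R) (d : ∀ i : ℤ, F i →ₗ[R] F (i + 1)),
    (∀ i, Module.Flat R (F i)) ∧
    (∀ i, LinearMap.range (d i) = LinearMap.ker (d (i + 1))) ∧
    Nonempty (M ≃ₗ[R] LinearMap.range (d 0)) ∧
    (∀ I : ModuleCat.{u} R, Module.Injective R I →
      ∀ i : ℤ, LinearMap.range (LinearMap.lTensor (R := R) (M := I) (d i)) =
        LinearMap.ker (LinearMap.lTensor (R := R) (M := I) (d (i + 1))))

/-- A commutative ring is **coherent** if every finitely generated ideal is finitely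
presented (as an `R`-module). -/
def IsCoherentRing (R : Type u) [CommRing R] : Prop :=
  ∀ I : Ideal R, I.FG → Module.FinitePresentation R I

/-- An `R`-module `M` is **FP-injective** if `Ext¹_R(P, M) = 0` for every finitely
presented `R`-module `P`; equivalently, every short exact sequence `0 → M → E → P → 0`
with `P` finitely presented splits. -/
def IsFPInjective (R : Type u) [CommRing R] (M : Type u)
    [AddCommGroup M] [Module R M] : Prop :=
  ∀ P : ModuleCat.{u} R, Module.FinitePresentation R P →
    ∀ (E : ModuleCat.{u} R) (i : M →ₗ[R] E) (p : E →ₗ[R] P),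
      Function.Injective i → Function.Surjective p →
      LinearMap.range i = LinearMap.ker p →
      ∃ r : E →ₗ[R] M, r.comp i = LinearMap.id

theorem exists_int_seq {α : Type*} {r : α → α → Prop} (hl : ∀ a, ∃ b, r b a)
    (hr : ∀ a, ∃ b, r a b) (a : α) : ∃ f : ℤ → α, f 1 = a ∧ ∀ i, r (f i) (f (i + 1)) := by
  choose p hp using hl
  choose s hs using hr
  refine ⟨fun i => match i with
    | Int.ofNat 0 => p a
    | Int.ofNat (n + 1) => s^[n] a
    | Int.negSucc n => p^[n + 2] a, rfl, fun i => ?_⟩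
  match i with
  | Int.ofNat 0 => exact hp a
  | Int.ofNat (n + 1) =>
    have h : r (s^[n] a) (s^[n + 1] a) := by
      rw [Function.iterate_succ_apply']
      exact hs _
    exact h
  | Int.negSucc 0 => exact hp (p a)
  | Int.negSucc (n + 1) =>
    have h : r (p^[n + 3] a) (p^[n + 2] a) := by
      rw [Function.iterate_succ_apply' p (n + 2)]
      exact hp _
    exact h

theorem exists_injective_embedding (R : Type u) [CommRing R] (M : ModuleCat.{u} R) :
    ∃ (E : ModuleCat.{u} R) (j : M →ₗ[R] E), Module.Injective R E ∧ Function.Injective j := by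
  obtain ⟨P⟩ := CategoryTheory.EnoughInjectives.presentation M
  exact ⟨P.J, P.f.hom, (Module.injective_iff_injective_object R _).2 P.injective,
    (ModuleCat.mono_iff_injective P.f).1 P.mono⟩

theorem isGorensteinFlat_of_injective_flat (R : Type u) [CommRing R]
    (h : ∀ E : ModuleCat.{u} R, Module.Injective R E → Module.Flat R E)
    (M : Type u) [AddCommGroup M] [Module R M] : IsGorensteinFlat R M := by
  let r (X Y : ModuleCat.{u} R) : Prop := ∃ (F : ModuleCat.{u} R) (f : X →ₗ[R] F) (g : F →ₗ[R] Y),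
    Module.Flat R F ∧ Function.Injective f ∧ Function.Exact f g ∧ Function.Surjective g
  have hl (Y : ModuleCat.{u} R) : ∃ X, r X Y := by
    let g := Finsupp.linearCombination R (id : Y → Y)
    exact ⟨ModuleCat.of R (LinearMap.ker g), ModuleCat.of R (Y →₀ R), (LinearMap.ker g).subtype, g,
      inferInstanceAs (Module.Flat R (Y →₀ R)), Subtype.val_injective,
      LinearMap.exact_subtype_ker_map g, Finsupp.linearCombination_id_surjective R Y⟩
  have hr (X : ModuleCat.{u} R) : ∃ Y, r X Y := by
    obtain ⟨E, j, hE, hj⟩ := exists_injective_embedding R X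
    exact ⟨ModuleCat.of R (E ⧸ LinearMap.range j), E, j, (LinearMap.range j).mkQ, h E hE, hj,
      LinearMap.exact_map_mkQ_range j, Submodule.mkQ_surjective _⟩
  obtain ⟨Z, hZ, hr⟩ := exists_int_seq hl hr (ModuleCat.of R M)
  choose F f g hF hf hfg hg using hr
  have hd (i : ℤ) : Function.Exact (f (i + 1) ∘ₗ g i) (f (i + 1 + 1) ∘ₗ g (i + 1)) := by
    rw [LinearMap.exact_iff, LinearMap.range_comp_of_range_eq_top _
      (LinearMap.range_eq_top.2 (hg i)), LinearMap.ker_comp_of_ker_eq_bot _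
      (LinearMap.ker_eq_bot.2 (hf (i + 1 + 1))), (hfg (i + 1)).linearMap_ker_eq]
  refine ⟨F, fun i => f (i + 1) ∘ₗ g i, hF, fun i => (hd i).linearMap_ker_eq.symm, ?_,
    fun I hI i => ?_⟩
  · rw [LinearMap.range_comp_of_range_eq_top _ (LinearMap.range_eq_top.2 (hg 0))]
    exact ⟨(CategoryTheory.eqToIso hZ.symm).toLinearEquiv ≪≫ₗ LinearEquiv.ofInjective _ (hf _)⟩
  · have := h I hI
    exact (Module.Flat.lTensor_exact I (hd i)).linearMap_ker_eq.symm

/-- The column space of every matrix over `R` is the null space of some matrix. -/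
def ColumnSpacesAreNullSpaces (R : Type u) [CommRing R] : Prop :=
  ∀ (n m : ℕ) (A : Matrix (Fin n) (Fin m) R), ∃ (k : ℕ) (B : Matrix (Fin k) (Fin n) R),
    Function.Exact A.mulVec B.mulVec

/-- The null space of every matrix over `R` is the column space of some matrix. -/
def NullSpacesAreColumnSpaces (R : Type u) [CommRing R] : Prop :=
  ∀ (n m : ℕ) (A : Matrix (Fin n) (Fin m) R), ∃ (k : ℕ) (C : Matrix (Fin m) (Fin k) R),
    Function.Exact C.mulVec A.mulVec

/-- Every functional on `R^m` vanishing on the null space of `A` is a combination of the rows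
of `A`. -/
def FunctionalsExtend (R : Type u) [CommRing R] : Prop :=
  ∀ (n m : ℕ) (A : Matrix (Fin n) (Fin m) R) (v : Fin m → R),
    (∀ x, A.mulVec x = 0 → v ⬝ᵥ x = 0) → ∃ w, A.transpose.mulVec w = v

section Matrix

variable {R : Type u} [CommRing R]

open Matrix

theorem mul_eq_zero_of_exact_mulVec {n m k : ℕ} {A : Matrix (Fin n) (Fin m) R}
    {B : Matrix (Fin k) (Fin n) R} (h : Function.Exact A.mulVec B.mulVec) : B * A = 0 :=
  Matrix.ext_of_mulVec_single fun i => by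
    rw [← Matrix.mulVec_mulVec, h.apply_apply_eq_zero, Matrix.zero_mulVec]

theorem ColumnSpacesAreNullSpaces.functionalsExtend (h : ColumnSpacesAreNullSpaces R) :
    FunctionalsExtend R := by
  intro n m A v hv
  obtain ⟨k, B, hB⟩ := h _ _ Aᵀ
  refine (hB v).1 ?_
  have hAB : A * Bᵀ = 0 := by
    simpa using congrArg transpose (mul_eq_zero_of_exact_mulVec hB)
  refine dotProduct_eq_zero _ fun y => ?_
  rw [dotProduct_comm, dotProduct_mulVec, ← mulVec_transpose, dotProduct_comm]
  exact hv _ (by rw [mulVec_mulVec, hAB, zero_mulVec])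

theorem ColumnSpacesAreNullSpaces.nullSpacesAreColumnSpaces (h : ColumnSpacesAreNullSpaces R) :
    NullSpacesAreColumnSpaces R := by
  intro n m A
  obtain ⟨k, B, hB⟩ := h _ _ Aᵀ
  obtain ⟨l, D, hD⟩ := h _ _ Bᵀ
  have hAB : A * Bᵀ = 0 := by
    simpa using congrArg transpose (mul_eq_zero_of_exact_mulVec hB)
  have hBD : B * Dᵀ = 0 := by
    simpa using congrArg transpose (mul_eq_zero_of_exact_mulVec hD)
  refine ⟨k, Bᵀ, fun v => ⟨fun hv => (hD v).1 ?_, ?_⟩⟩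
  · refine dotProduct_eq_zero _ fun y => ?_
    obtain ⟨w, hw⟩ := (hB (Dᵀ *ᵥ y)).1 (by rw [mulVec_mulVec, hBD, zero_mulVec])
    rw [dotProduct_comm, dotProduct_mulVec, ← mulVec_transpose, ← hw, mulVec_transpose,
      ← dotProduct_mulVec, hv, dotProduct_zero]
  · rintro ⟨y, rfl⟩
    rw [mulVec_mulVec, hAB, zero_mulVec]

theorem NullSpacesAreColumnSpaces.columnSpacesAreNullSpaces (h : NullSpacesAreColumnSpaces R)
    (h' : FunctionalsExtend R) : ColumnSpacesAreNullSpaces R := by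
  intro n m A
  obtain ⟨k, C, hC⟩ := h _ _ Aᵀ
  have hCA : Cᵀ * A = 0 := by
    simpa using congrArg transpose (mul_eq_zero_of_exact_mulVec hC)
  refine ⟨k, Cᵀ, fun v => ⟨fun hv => ?_, ?_⟩⟩
  · refine h' _ _ Aᵀ v fun x hx => ?_
    obtain ⟨y, rfl⟩ := (hC x).1 hx
    rw [dotProduct_mulVec, ← mulVec_transpose, hv, zero_dotProduct]
  · rintro ⟨y, rfl⟩
    rw [mulVec_mulVec, hCA, zero_mulVec]

theorem NullSpacesAreColumnSpaces.isCoherentRing (h : NullSpacesAreColumnSpaces R) :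
    IsCoherentRing R := by
  intro I hI
  have : Module.Finite R I := .of_fg hI
  obtain ⟨n, f, hf⟩ := Module.Finite.exists_fin' R I
  let g := LinearMap.pi (fun _ : Fin 1 => I.subtype ∘ₗ f)
  obtain ⟨k, C, hC⟩ := h _ _ (LinearMap.toMatrix' g)
  refine Module.finitePresentation_of_free_of_surjective f hf ?_
  have : LinearMap.ker f = LinearMap.range C.mulVecLin := by
    ext x
    have := hC x
    rw [LinearMap.toMatrix'_mulVec] at this
    rw [LinearMap.mem_ker, LinearMap.mem_range]
    simpa [g, funext_iff] using this
  rw [this]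
  exact Submodule.fg_range _

theorem IsCoherentRing.nullSpacesAreColumnSpaces (h : IsCoherentRing R) :
    NullSpacesAreColumnSpaces R := by
  intro n
  induction n with
  | zero => exact fun m A => ⟨m, 1, fun x => by simp⟩
  | succ n ih =>
    intro m A
    let f := dotProductBilin R R (A 0)
    have := h (LinearMap.range f) (Submodule.fg_range f)
    have hker := Module.FinitePresentation.fg_ker _ f.surjective_rangeRestrict
    rw [LinearMap.ker_rangeRestrict] at hker
    obtain ⟨k, g, hg⟩ := (Submodule.fg_iff_exists_fin_linearMap R _).1 hker
    obtain ⟨l, C, hC⟩ := ih k (A.submatrix Fin.succ id * LinearMap.toMatrix' g)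
    refine ⟨l, LinearMap.toMatrix' g * C, fun x => ?_⟩
    have hx : A *ᵥ x = 0 ↔ x ∈ LinearMap.range g ∧ A.submatrix Fin.succ id *ᵥ x = 0 := by
      rw [hg]
      exact ⟨fun h => ⟨congrFun h 0, funext fun i => congrFun h i.succ⟩,
        fun h => funext fun i => Fin.cases h.1 (fun i => congrFun h.2 i) i⟩
    have hC' (y : Fin k → R) : A.submatrix Fin.succ id *ᵥ g y = 0 ↔ y ∈ Set.range C.mulVec := by
      rw [← hC y, ← mulVec_mulVec, LinearMap.toMatrix'_mulVec]
    rw [hx]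
    constructor
    · rintro ⟨⟨y, rfl⟩, hy⟩
      obtain ⟨z, rfl⟩ := (hC' y).1 hy
      exact ⟨z, by rw [← mulVec_mulVec, LinearMap.toMatrix'_mulVec]⟩
    · rintro ⟨z, rfl⟩
      rw [← mulVec_mulVec, LinearMap.toMatrix'_mulVec]
      exact ⟨⟨_, rfl⟩, (hC' _).2 ⟨z, rfl⟩⟩

theorem IsFPInjective.functionalsExtend (h : IsFPInjective R R) : FunctionalsExtend R := by
  intro n m A v hv
  let φ : (Fin m → R) →ₗ[R] R × (Fin n → R) := (dotProductBilin R R v).prod (-A.mulVecLin)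
  let p := (LinearMap.range φ).mapQ (LinearMap.range A.mulVecLin)
    (LinearMap.snd R R (Fin n → R)) <| by
    rintro _ ⟨x, rfl⟩
    exact ⟨-x, by simp [φ, mulVec_neg]⟩
  obtain ⟨r, hr⟩ := h (ModuleCat.of R ((Fin n → R) ⧸ LinearMap.range A.mulVecLin))
    (Module.finitePresentation_of_surjective _ (Submodule.mkQ_surjective _)
      (by rw [Submodule.ker_mkQ]; exact Submodule.fg_range _))
    (ModuleCat.of R ((R × (Fin n → R)) ⧸ LinearMap.range φ))
    ((LinearMap.range φ).mkQ ∘ₗ LinearMap.inl R R (Fin n → R)) p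
    (by
      refine (injective_iff_map_eq_zero _).2 fun a ha => ?_
      obtain ⟨x, hx⟩ := (Submodule.Quotient.mk_eq_zero _).1 ha
      have hx' := Prod.ext_iff.1 hx
      exact hx'.1.symm.trans (hv x (neg_eq_zero.1 hx'.2)))
    (by
      intro y
      obtain ⟨y, rfl⟩ := Submodule.mkQ_surjective _ y
      exact ⟨(LinearMap.range φ).mkQ (0, y), rfl⟩)
    (by
      ext y
      obtain ⟨⟨a, y⟩, rfl⟩ := Submodule.mkQ_surjective _ y
      constructor
      · rintro ⟨b, hb⟩
        rw [← hb]
        exact (Submodule.Quotient.mk_eq_zero _).2 (zero_mem _)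
      · intro hy
        obtain ⟨x, hx⟩ := (Submodule.Quotient.mk_eq_zero _).1 hy
        refine ⟨a + v ⬝ᵥ x, (Submodule.Quotient.eq _).2 ⟨x, ?_⟩⟩
        have hx : A *ᵥ x = y := hx
        simp [φ, hx, dotProductBilin])
  let s : (Fin n → R) →ₗ[R] R := r ∘ₗ (LinearMap.range φ).mkQ ∘ₗ LinearMap.inr R R (Fin n → R)
  have hs (x : Fin m → R) : s (A *ᵥ x) = v ⬝ᵥ x := by
    rw [← show r ((LinearMap.range φ).mkQ (v ⬝ᵥ x, 0)) = v ⬝ᵥ x from LinearMap.congr_fun hr _]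
    refine congrArg r ((Submodule.Quotient.eq _).2 ⟨-x, ?_⟩)
    simp [φ, dotProductBilin, mulVec_neg]
  obtain ⟨w, hw⟩ := (dotProductEquiv R (Fin n)).surjective s
  refine ⟨w, dotProduct_eq _ _ fun x => ?_⟩
  rw [mulVec_transpose, ← dotProduct_mulVec, ← hs, ← hw]
  rfl

theorem FunctionalsExtend.isFPInjective (h : FunctionalsExtend R) : IsFPInjective R R := by
  intro P hP E i p hi hp hip
  obtain ⟨n, m, f, g, hf, hgf⟩ := Module.FinitePresentation.exists_fin' R P
  obtain ⟨l, hl⟩ := Module.projective_lifting_property p f hp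
  have hlg (x : Fin m → R) : l (g x) ∈ LinearMap.range i := by
    rw [hip, LinearMap.mem_ker, ← LinearMap.comp_apply p l, hl, hgf.apply_apply_eq_zero]
  let c : (Fin m → R) →ₗ[R] R :=
    (LinearEquiv.ofInjective i hi).symm ∘ₗ (l ∘ₗ g).codRestrict (LinearMap.range i) hlg
  have hc (x : Fin m → R) : i (c x) = l (g x) :=
    congrArg Subtype.val ((LinearEquiv.ofInjective i hi).apply_symm_apply _)
  obtain ⟨v, hv⟩ := (dotProductEquiv R (Fin m)).surjective c
  have hv' (x : Fin m → R) : v ⬝ᵥ x = c x := LinearMap.congr_fun hv x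
  obtain ⟨w, hw⟩ := h _ _ (LinearMap.toMatrix' g) v fun x hx => by
    rw [LinearMap.toMatrix'_mulVec] at hx
    exact hi (by rw [hv', hc, hx, map_zero, map_zero])
  let l' : (Fin n → R) →ₗ[R] E := l - i ∘ₗ dotProductBilin R R w
  have hl' : LinearMap.ker f ≤ LinearMap.ker l' := by
    intro y hy
    obtain ⟨x, rfl⟩ := (hgf y).1 hy
    have : w ⬝ᵥ g x = c x := by
      rw [← hv', ← hw, mulVec_transpose, ← dotProduct_mulVec, LinearMap.toMatrix'_mulVec]
    change l (g x) - i (w ⬝ᵥ g x) = 0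
    rw [this, hc, sub_self]
  have hpl' (y : Fin n → R) : p (l' y) = f y := by
    have h0 : p (i (w ⬝ᵥ y)) = 0 := hip.le ⟨_, rfl⟩
    change p (l y - i (w ⬝ᵥ y)) = f y
    rw [map_sub, h0, sub_zero, ← hl, LinearMap.comp_apply]
  have hex : Function.Exact i p := LinearMap.exact_iff.2 hip.symm
  have hs : ∃ s, p ∘ₗ s = LinearMap.id := by
    refine ⟨(LinearMap.ker f).liftQ l' hl' ∘ₗ (f.quotKerEquivOfSurjective hf).symm, ?_⟩
    ext y
    obtain ⟨y, rfl⟩ := hf y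
    have : (f.quotKerEquivOfSurjective hf).symm (f y) = (LinearMap.ker f).mkQ y := by
      rw [LinearEquiv.symm_apply_eq]
      rfl
    simp [this, hpl']
  exact (((hex.split_tfae hi hp).out 0 1).1 hs :)

theorem ColumnSpacesAreNullSpaces.flat_of_injective (h : ColumnSpacesAreNullSpaces R)
    (E : ModuleCat.{u} R) (hE : Module.Injective R E) : Module.Flat R E := by
  refine Module.Flat.of_forall_exists_factorization fun {l f x} hx => ?_
  let e := Finsupp.linearEquivFunOnFinite R R (Fin l)
  obtain ⟨k, B, hB⟩ := h l 1 (Matrix.of fun i _ => f i)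
  let e' := Finsupp.linearEquivFunOnFinite R R (Fin k)
  let b : (Fin l →₀ R) →ₗ[R] (Fin k → R) := B.mulVecLin ∘ₗ e
  have hbf : b f = 0 := (hB _).2 ⟨fun _ => 1, by ext; simp [e, mulVec, dotProduct]⟩
  have hbx : LinearMap.ker b ≤ LinearMap.ker x := by
    intro y hy
    obtain ⟨c, hc⟩ := (hB _).1 (LinearMap.mem_ker.1 hy)
    have : y = c 0 • f := e.injective <| by
      refine hc.symm.trans ?_
      ext
      simp [e, mulVec, dotProduct, mul_comm]
    rw [this, LinearMap.mem_ker, map_smul, hx, smul_zero]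
  obtain ⟨y, hy⟩ := hE.out ((LinearMap.ker b).liftQ b le_rfl)
    (LinearMap.ker_eq_bot.1 (Submodule.ker_liftQ_eq_bot _ _ _ le_rfl))
    ((LinearMap.ker b).liftQ x hbx)
  refine ⟨k, e'.symm ∘ₗ b, y ∘ₗ e', LinearMap.ext fun z => ?_, by simp [hbf]⟩
  simpa using (hy ((LinearMap.ker b).mkQ z)).symm

theorem columnSpacesAreNullSpaces_of_exists_flat_embedding
    (h : ∀ M : ModuleCat.{u} R, ∃ (F : ModuleCat.{u} R) (j : M →ₗ[R] F),
      Module.Flat R F ∧ Function.Injective j) :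
    ColumnSpacesAreNullSpaces R := by
  intro n m A
  let K := LinearMap.range A.mulVecLin
  obtain ⟨F, j, hF, hj⟩ := h (ModuleCat.of R ((Fin n → R) ⧸ K))
  have : Module.FinitePresentation R ((Fin n → R) ⧸ K) :=
    Module.finitePresentation_of_surjective _ K.mkQ_surjective
      (by rw [Submodule.ker_mkQ]; exact Submodule.fg_range _)
  obtain ⟨k, a, b, hab⟩ :=
    Module.Flat.exists_factorization_of_finitePresentation (P := (Fin n → R) ⧸ K) j
  have ha : Function.Injective a := by
    rw [hab] at hj
    exact Function.Injective.of_comp hj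
  let e := Finsupp.linearEquivFunOnFinite R R (Fin k)
  refine ⟨k, LinearMap.toMatrix' (e.toLinearMap ∘ₗ a ∘ₗ K.mkQ), fun v => ?_⟩
  rw [LinearMap.toMatrix'_mulVec, LinearMap.comp_apply, LinearMap.comp_apply, LinearEquiv.coe_coe,
    e.map_eq_zero_iff, map_eq_zero_iff a ha, Submodule.mkQ_apply, Submodule.Quotient.mk_eq_zero]
  rfl

end Matrix

theorem IsGorensteinFlat.exists_flat_embedding {R : Type u} [CommRing R] {M : Type u}
    [AddCommGroup M] [Module R M] (h : IsGorensteinFlat R M) :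
    ∃ (F : ModuleCat.{u} R) (j : M →ₗ[R] F), Module.Flat R F ∧ Function.Injective j := by
  obtain ⟨F, d, hF, -, ⟨e⟩, -⟩ := h
  exact ⟨F (0 + 1), (LinearMap.range (d 0)).subtype ∘ₗ e, hF _,
    Subtype.val_injective.comp e.injective⟩

/-- `R` is Gorenstein Von Neumann regular iff `R` is coherent and self-FP-injective,
i.e. `R` is a weakly quasi-Frobenius (FC) ring. -/
theorem gorensteinVonNeumannRegular_iff_coherent_selfFPInjective
    (R : Type u) [CommRing R] :
    (∀ (M : Type u) [AddCommGroup M] [Module R M], IsGorensteinFlat R M) ↔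
    (IsCoherentRing R ∧ IsFPInjective R R) := by
  constructor
  · intro h
    have hR : ColumnSpacesAreNullSpaces R :=
      columnSpacesAreNullSpaces_of_exists_flat_embedding fun M => (h M).exists_flat_embedding
    exact ⟨hR.nullSpacesAreColumnSpaces.isCoherentRing, hR.functionalsExtend.isFPInjective⟩
  · rintro ⟨hc, hfp⟩ M _ _
    exact isGorensteinFlat_of_injective_flat R (hc.nullSpacesAreColumnSpaces
      |>.columnSpacesAreNullSpaces hfp.functionalsExtend).flat_of_injective M
end

section
/- Let R be a coherent commutative ring. Then R is Gorenstein Von Neumann regular (every R-module is Gorenstein flat) if and only if for every finitely generated ideal I of R the module R/I is Gorenstein flat. -/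
universe u

namespace LinearMap

variable {R : Type*} [CommRing R]

/-- If `A → B → C` is exact at `B` and stays exact after tensoring with `E`, then tensoring with
`E` preserves the injectivity of the inclusion of the image of `B → C` into `C`. -/
lemma lTensor_range_subtype_injective {A B C : Type*} [AddCommGroup A] [Module R A]
    [AddCommGroup B] [Module R B] [AddCommGroup C] [Module R C]
    (E : Type*) [AddCommGroup E] [Module R E] (f : A →ₗ[R] B) (g : B →ₗ[R] C)
    (hfg : range f = ker g) (hE : range (f.lTensor E) = ker (g.lTensor E)) :
    Function.Injective ((range g).subtype.lTensor E) := by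
  rw [injective_iff_map_eq_zero]
  intro x hx
  obtain ⟨y, rfl⟩ := lTensor_surjective E g.surjective_rangeRestrict x
  have hy : y ∈ ker (g.lTensor E) := by
    rwa [← comp_apply, ← lTensor_comp] at hx
  rw [← hE] at hy
  obtain ⟨z, rfl⟩ := hy
  have h0 : g.rangeRestrict ∘ₗ f = 0 := by
    ext a
    have : f a ∈ ker g := hfg ▸ mem_range_self f a
    simpa using this
  rw [← comp_apply, ← lTensor_comp, h0, lTensor_zero, zero_apply]

/-- Let `0 → K → F → M → 0` and `0 → P → Q → M → 0` be short exact sequences with `F` flat and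
`Q` projective. If `E ⊗ K → E ⊗ F` is injective, then so is `E ⊗ P → E ⊗ Q`. -/
lemma lTensor_injective_of_flat_of_projective {K F P Q M : Type*}
    [AddCommGroup K] [Module R K] [AddCommGroup F] [Module R F] [AddCommGroup P] [Module R P]
    [AddCommGroup Q] [Module R Q] [AddCommGroup M] [Module R M]
    [Module.Flat R F] [Module.Projective R Q] (E : Type*) [AddCommGroup E] [Module R E]
    {k : K →ₗ[R] F} {p : F →ₗ[R] M} (hk : Function.Injective k) (hkp : Function.Exact k p)
    (hp : Function.Surjective p)
    {j : P →ₗ[R] Q} {q : Q →ₗ[R] M} (hj : Function.Injective j) (hjq : Function.Exact j q)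
    (hq : Function.Surjective q) (hE : Function.Injective (k.lTensor E)) :
    Function.Injective (j.lTensor E) := by
  obtain ⟨g, hg⟩ := Module.projective_lifting_property p q hp
  have hpg (x : Q) : p (g x) = q x := DFunLike.congr_fun hg x
  have hgj (x : P) : g (j x) ∈ range k := (hkp _).1 (by rw [hpg, hjq.apply_apply_eq_zero])
  let h : P →ₗ[R] K := (LinearEquiv.ofInjective k hk).symm.toLinearMap ∘ₗ
    (g ∘ₗ j).codRestrict (range k) hgj
  have hkh (x : P) : k (h x) = g (j x) :=
    congr_arg Subtype.val ((LinearEquiv.ofInjective k hk).apply_symm_apply ⟨g (j x), hgj x⟩)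
  have hkh' : k ∘ₗ h = g ∘ₗ j := ext hkh
  have hexact : Function.Exact (h.prod j) (k.coprod (-g)) := by
    rintro ⟨a, b⟩
    constructor
    · intro hab
      have hab : k a = g b := by simpa [add_neg_eq_zero] using hab
      obtain ⟨x, rfl⟩ := (hjq b).1 (by rw [← hpg, ← hab, hkp.apply_apply_eq_zero])
      exact ⟨x, Prod.ext (hk (by simp [hkh, hab])) rfl⟩
    · rintro ⟨x, hx⟩
      rw [← hx]
      simp [hkh]
  have hsurj : Function.Surjective (k.coprod (-g)) := by
    intro f
    obtain ⟨b, hb⟩ := hq (p f)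
    obtain ⟨a, ha⟩ := (hkp (f - g b)).1 (by rw [map_sub, hpg, hb, sub_self])
    exact ⟨(a, -b), by simp [ha]⟩
  have hinj : Function.Injective (h.prod j) := fun x y hxy ↦ hj (congr_arg Prod.snd hxy)
  have key := lTensor_injective_of_exact_of_flat _ hsurj _ hinj hexact E
  rw [injective_iff_map_eq_zero]
  intro z hz
  have hhz : h.lTensor E z = 0 := hE <| by
    rw [← comp_apply, ← lTensor_comp, hkh', lTensor_comp, comp_apply, hz, map_zero, map_zero]
  clear_value h
  have hsum : h.prod j = inl R K Q ∘ₗ h + inr R K Q ∘ₗ j := by ext <;> simp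
  refine key ?_
  rw [map_zero, hsum, lTensor_add, add_apply, lTensor_comp, lTensor_comp, comp_apply, comp_apply,
    hhz, hz, map_zero, map_zero, add_zero]

end LinearMap

/-- If every quotient of `R` by a finitely generated ideal is Gorenstein flat, then every
injective `R`-module is flat. -/
lemma Module.Flat.of_injective_of_quotients_gorensteinFlat {R : Type u} [CommRing R]
    (H : ∀ I : Ideal R, I.FG → IsGorensteinFlat R (R ⧸ I))
    (E : Type u) [AddCommGroup E] [Module R E] (hE : Module.Injective R E) :
    Module.Flat R E := by
  rw [Module.Flat.iff_lTensor_injective]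
  intro I hI
  obtain ⟨F, d, hflat, hd, ⟨e⟩, hT⟩ := H I hI
  obtain ⟨n, hn⟩ : ∃ n : ℤ, (0 : ℤ) = n + 1 + 1 := ⟨-2, rfl⟩
  rw [hn] at e
  have hK := LinearMap.lTensor_range_subtype_injective E (d n) (d (n + 1)) (hd n)
    (hT (ModuleCat.of R E) hE n)
  have := hflat (n + 1 + 1)
  refine LinearMap.lTensor_injective_of_flat_of_projective E
    (p := e.symm.toLinearMap ∘ₗ (d (n + 1 + 1)).rangeRestrict) (q := I.mkQ)
    (Submodule.injective_subtype _) ?_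
    (e.symm.surjective.comp (d (n + 1 + 1)).surjective_rangeRestrict)
    (Submodule.injective_subtype _) ?_ I.mkQ_surjective hK
  · rw [LinearMap.exact_iff, LinearEquiv.ker_comp, LinearMap.ker_rangeRestrict,
      Submodule.range_subtype, hd]
  · rw [LinearMap.exact_iff, Submodule.ker_mkQ, Submodule.range_subtype]

/-- A relation in which every element has a successor and a predecessor admits a bi-infinite
chain through any element. -/
lemma exists_int_chain {α : Type*} {r : α → α → Prop} (hs : ∀ a, ∃ b, r a b)
    (hp : ∀ b, ∃ a, r a b) (a : α) (n : ℤ) :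
    ∃ z : ℤ → α, z n = a ∧ ∀ i, r (z i) (z (i + 1)) := by
  choose s hs using hs
  choose p hp using hp
  let z : ℤ → α
    | .ofNat m => s^[m] a
    | .negSucc m => p^[m + 1] a
  have hz : ∀ i, r (z i) (z (i + 1)) := by
    rintro (m | m | m)
    · change r (s^[m] a) (s^[m + 1] a)
      rw [Function.iterate_succ_apply']
      exact hs _
    · exact hp a
    · change r (p^[m + 1 + 1] a) (p^[m + 1] a)
      rw [Function.iterate_succ_apply' p (m + 1)]
      exact hp _
  refine ⟨fun i ↦ z (i - n), by simp [z], fun i ↦ ?_⟩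
  simpa only [add_sub_right_comm] using hz (i - n)

/-- `B` is the cokernel of an embedding of `A` into a flat module. -/
def IsFlatCosyzygy {R : Type u} [CommRing R] (A B : ModuleCat.{u} R) : Prop :=
  ∃ (F : ModuleCat.{u} R) (f : A →ₗ[R] F) (g : F →ₗ[R] B), Module.Flat R F ∧
    Function.Injective f ∧ LinearMap.range f = LinearMap.ker g ∧ Function.Surjective g

lemma exists_isFlatCosyzygy_left {R : Type u} [CommRing R] (B : ModuleCat.{u} R) :
    ∃ A : ModuleCat.{u} R, IsFlatCosyzygy A B := by
  let g : (B →₀ R) →ₗ[R] B := Finsupp.linearCombination R id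
  exact ⟨ModuleCat.of R (LinearMap.ker g), ModuleCat.of R (B →₀ R), (LinearMap.ker g).subtype, g,
    inferInstanceAs (Module.Flat R (B →₀ R)), Submodule.injective_subtype _,
    Submodule.range_subtype _, Finsupp.linearCombination_id_surjective R B⟩

lemma exists_isFlatCosyzygy_right {R : Type u} [CommRing R]
    (H : ∀ (E : Type u) [AddCommGroup E] [Module R E], Module.Injective R E → Module.Flat R E)
    (A : ModuleCat.{u} R) : ∃ B : ModuleCat.{u} R, IsFlatCosyzygy A B := by
  let E := CategoryTheory.Injective.under A
  let f : A →ₗ[R] E := (CategoryTheory.Injective.ι A).hom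
  have : CategoryTheory.Injective (ModuleCat.of R E) :=
    inferInstanceAs (CategoryTheory.Injective (CategoryTheory.Injective.under A))
  exact ⟨ModuleCat.of R (E ⧸ LinearMap.range f), E, f, (LinearMap.range f).mkQ,
    H E (Module.injective_module_of_injective_object R E),
    (ModuleCat.mono_iff_injective (CategoryTheory.Injective.ι A)).1 inferInstance,
    (Submodule.ker_mkQ _).symm, Submodule.mkQ_surjective _⟩

/-- If every injective module is flat, then every module is Gorenstein flat. -/
lemma IsGorensteinFlat.of_flat_of_injective {R : Type u} [CommRing R]
    (H : ∀ (E : Type u) [AddCommGroup E] [Module R E], Module.Injective R E → Module.Flat R E)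
    (M : Type u) [AddCommGroup M] [Module R M] : IsGorensteinFlat R M := by
  obtain ⟨Z, hZ, hr⟩ := exists_int_chain (exists_isFlatCosyzygy_right H)
    exists_isFlatCosyzygy_left (ModuleCat.of R M) (0 + 1)
  choose F f g hF hf hfg hg using hr
  have hrange (i : ℤ) : LinearMap.range (f (i + 1) ∘ₗ g i) = LinearMap.range (f (i + 1)) :=
    LinearMap.range_comp_of_range_eq_top _ (LinearMap.range_eq_top.2 (hg i))
  have hd (i : ℤ) : LinearMap.range (f (i + 1) ∘ₗ g i) =
      LinearMap.ker (f (i + 1 + 1) ∘ₗ g (i + 1)) := by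
    rw [hrange, hfg, LinearMap.ker_comp_of_ker_eq_bot _ (LinearMap.ker_eq_bot.2 (hf _))]
  refine ⟨F, fun i ↦ f (i + 1) ∘ₗ g i, hF, hd, ?_, fun I hI i ↦ ?_⟩
  · rw [hrange]
    exact ⟨(CategoryTheory.eqToIso hZ.symm).toLinearEquiv ≪≫ₗ LinearEquiv.ofInjective _ (hf _)⟩
  · have := H I hI
    exact (LinearMap.exact_iff.1
      (Module.Flat.lTensor_exact I (LinearMap.exact_iff.2 (hd i).symm))).symm

/-- A coherent commutative ring `R` is Gorenstein Von Neumann regular iff `R/I` is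
Gorenstein flat for every finitely generated ideal `I` of `R`. -/
theorem coherent_gorensteinVonNeumannRegular_iff_quotients_gorensteinFlat
    (R : Type u) [CommRing R] (hcoh : IsCoherentRing R) :
    (∀ (M : Type u) [AddCommGroup M] [Module R M], IsGorensteinFlat R M) ↔
    (∀ I : Ideal R, I.FG → IsGorensteinFlat R (R ⧸ I)) := by
  refine ⟨fun h I _ ↦ h (R ⧸ I), fun h M _ _ ↦ ?_⟩
  exact IsGorensteinFlat.of_flat_of_injective
    (fun E _ _ hE ↦ Module.Flat.of_injective_of_quotients_gorensteinFlat h E hE) M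
end
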